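/- Let x, y ∈ ℝ² with dist(x,y) = d and 0 < d < 2r. Among all κ-constrained curves (κ = 1/r) from x to y whose image is NOT contained in the closed lens cl(I), the minimum length is r·(2π − 2·arcsin(d/(2r))), achieved by the longer arcs of the two radius-r circles through x and y. -/

import Mathlib

open Set Metric Real

noncomputable section

abbrev Plane := EuclideanSpace ℝ (Fin 2)

def IsKConstrained (κ s : ℝ) (σ σ' σ'' : ℝ → Plane) : Prop :=
  0 ≤ s ∧
  (∀ t ∈ Icc (0:ℝ) s, HasDerivAt σ (σ' t) t) ∧
  ContinuousOn σ' (Icc 0 s) ∧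
  (∀ t ∈ Icc (0:ℝ) s, ‖σ' t‖ = 1) ∧
  ∃ F : Finset ℝ, ∀ t ∈ Icc (0:ℝ) s, t ∉ F →
    HasDerivAt σ' (σ'' t) t ∧ ‖σ'' t‖ ≤ κ

open MeasureTheory InnerProductGeometry Filter Topology

section General

variable {E : Type*} [NormedAddCommGroup E]

theorem norm_sub_le_of_norm_hasDerivAt_le_off_finset [NormedSpace ℝ E] [CompleteSpace E]
    {v v' : ℝ → E} {a b K : ℝ} (hab : a ≤ b) (hv : ContinuousOn v (Icc a b)) (F : Finset ℝ)
    (hd : ∀ t ∈ Icc a b, t ∉ F → HasDerivAt v (v' t) t ∧ ‖v' t‖ ≤ K) :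
    ‖v b - v a‖ ≤ K * (b - a) := by
  have hae : ∀ᵐ t : ℝ, t ∈ uIoc a b → ‖deriv v t‖ ≤ K := by
    filter_upwards [(F.finite_toSet.countable.ae_notMem volume)] with t htF ht
    rw [uIoc_of_le hab] at ht
    obtain ⟨h1, h2⟩ := hd t ⟨ht.1.le, ht.2⟩ htF
    rwa [h1.deriv]
  have hint : IntervalIntegrable (deriv v) volume a b := by
    rw [intervalIntegrable_iff]
    refine Measure.integrableOn_of_bounded (M := K) (by simp [uIoc])
      (stronglyMeasurable_deriv v).aestronglyMeasurable ?_
    exact (ae_restrict_iff' measurableSet_uIoc).2 hae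
  have h := integral_eq_of_hasDerivAt_off_countable_of_le v (deriv v) hab
    F.finite_toSet.countable hv (fun t ht => by
      obtain ⟨h1, -⟩ := hd t (Ioo_subset_Icc_self ht.1) ht.2
      exact h1.differentiableAt.hasDerivAt) hint
  rw [← h, ← abs_of_nonneg (sub_nonneg.2 hab)]
  exact intervalIntegral.norm_integral_le_of_norm_le_const_ae hae

variable [InnerProductSpace ℝ E]

theorem angle_le_two_mul_arcsin {u w : E} (hu : ‖u‖ = 1) (hw : ‖w‖ = 1) {δ : ℝ}
    (h : ‖u - w‖ ≤ δ) : angle u w ≤ 2 * arcsin (δ / 2) := by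
  have h0 := angle_nonneg u w
  have hpi := angle_le_pi u w
  have hs : 0 ≤ sin (angle u w / 2) := sin_nonneg_of_nonneg_of_le_pi (by linarith) (by linarith)
  have hn : ‖u - w‖ = 2 * sin (angle u w / 2) := by
    have h1 := norm_sub_sq_eq_norm_sq_add_norm_sq_sub_two_mul_norm_mul_norm_mul_cos_angle u w
    have h2 : cos (angle u w) = 1 - 2 * sin (angle u w / 2) ^ 2 := by
      have := cos_sq_add_sin_sq (angle u w / 2)
      have := cos_two_mul (angle u w / 2)
      rw [mul_div_cancel₀ _ two_ne_zero] at this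
      linarith
    rw [hu, hw, h2] at h1
    rw [← abs_of_nonneg (norm_nonneg (u - w)), ← abs_of_nonneg (mul_nonneg zero_le_two hs)]
    apply (sq_eq_sq_iff_abs_eq_abs _ _).1
    nlinarith
  have h3 : angle u w / 2 ≤ arcsin (δ / 2) := by
    rw [← arcsin_sin (x := angle u w / 2) (by linarith) (by linarith)]
    exact monotone_arcsin (by linarith)
  linarith

theorem tendsto_nat_mul_two_mul_arcsin (c : ℝ) :
    Tendsto (fun n : ℕ => ((n : ℝ) + 1) * (2 * arcsin (c / ((n : ℝ) + 1) / 2))) atTop (𝓝 c) := by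
  have h1 : HasDerivAt (fun x : ℝ => 2 * arcsin (c * x / 2)) c 0 := by
    have h2 : HasDerivAt (fun x : ℝ => c * x / 2) (c / 2) 0 := by
      simpa using ((hasDerivAt_id (0 : ℝ)).const_mul c).div_const 2
    have h3 : HasDerivAt arcsin 1 (c * 0 / 2) := by
      simpa using hasDerivAt_arcsin (x := 0) (by norm_num) (by norm_num)
    convert! (h3.comp 0 h2).const_mul 2 using 1
    ring
  have h4 := hasDerivAt_iff_tendsto_slope_zero.1 h1
  have h5 : Tendsto (fun n : ℕ => 1 / ((n : ℝ) + 1)) atTop (𝓝[≠] 0) :=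
    tendsto_nhdsWithin_iff.2 ⟨tendsto_one_div_add_atTop_nhds_zero_nat,
      Eventually.of_forall fun n => by simp; positivity⟩
  refine (h4.comp h5).congr fun n => ?_
  simp [div_eq_mul_inv]

theorem angle_le_mul_sub_of_lipschitz {v : ℝ → E} {a b K : ℝ} (hab : a ≤ b)
    (hv : ∀ t ∈ Icc a b, ‖v t‖ = 1)
    (hL : ∀ t ∈ Icc a b, ∀ u ∈ Icc a b, t ≤ u → ‖v u - v t‖ ≤ K * (u - t)) :
    angle (v a) (v b) ≤ K * (b - a) := by
  refine ge_of_tendsto' (tendsto_nat_mul_two_mul_arcsin (K * (b - a))) fun n => ?_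
  have hn : (0 : ℝ) < (n : ℝ) + 1 := by positivity
  have hh : 0 ≤ (b - a) / ((n : ℝ) + 1) := div_nonneg (sub_nonneg.2 hab) hn.le
  have hmem : ∀ k : ℕ, k ≤ n + 1 → a + k * ((b - a) / ((n : ℝ) + 1)) ∈ Icc a b := by
    intro k hk
    have hk' : (k : ℝ) ≤ (n : ℝ) + 1 := by exact_mod_cast hk
    refine ⟨by have := mul_nonneg (Nat.cast_nonneg (α := ℝ) k) hh; linarith, ?_⟩
    have := mul_le_mul_of_nonneg_right hk' hh
    rw [mul_div_cancel₀ _ hn.ne'] at this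
    linarith
  have key : ∀ k : ℕ, k ≤ n + 1 → angle (v a) (v (a + k * ((b - a) / ((n : ℝ) + 1)))) ≤
      k * (2 * arcsin (K * (b - a) / ((n : ℝ) + 1) / 2)) := by
    intro k
    induction k with
    | zero =>
      intro _
      have ha : v a ≠ 0 := by
        rw [← norm_ne_zero_iff, hv a ⟨le_rfl, hab⟩]; exact one_ne_zero
      simp [angle_self ha]
    | succ k ih =>
      intro hk
      have hk0 := hmem k (by omega)
      have hk1 := hmem (k + 1) hk
      have h1 := ih (by omega)
      have h2 := angle_le_two_mul_arcsin (hv _ hk0) (hv _ hk1)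
        (δ := K * (b - a) / ((n : ℝ) + 1)) (by
          rw [norm_sub_rev]
          refine (hL _ hk0 _ hk1 (by push_cast; linarith)).trans (le_of_eq ?_)
          push_cast
          ring)
      have h3 := angle_le_angle_add_angle (v a) (v (a + k * ((b - a) / ((n : ℝ) + 1))))
        (v (a + ((k + 1 : ℕ) : ℝ) * ((b - a) / ((n : ℝ) + 1))))
      push_cast at *
      linarith
  have h := key (n + 1) le_rfl
  push_cast at h
  rwa [mul_div_cancel₀ _ hn.ne', add_sub_cancel] at h

theorem cos_le_inner_of_lipschitz {v : ℝ → E} {a b K : ℝ} (hab : a ≤ b)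
    (hv : ∀ t ∈ Icc a b, ‖v t‖ = 1)
    (hL : ∀ t ∈ Icc a b, ∀ u ∈ Icc a b, t ≤ u → ‖v u - v t‖ ≤ K * (u - t))
    (hK : K * (b - a) ≤ π) : cos (K * (b - a)) ≤ inner ℝ (v a) (v b) := by
  have h := cos_le_cos_of_nonneg_of_le_pi (angle_nonneg _ _) hK
    (angle_le_mul_sub_of_lipschitz hab hv hL)
  rwa [cos_angle, hv a ⟨le_rfl, hab⟩, hv b ⟨hab, le_rfl⟩, mul_one, div_one] at h

theorem sq_inner_add_sq_inner_le {e n : E} (he : ‖e‖ = 1) (hn : ‖n‖ = 1) (hen : inner ℝ e n = 0)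
    (w : E) : inner ℝ e w ^ 2 + inner ℝ n w ^ 2 ≤ ‖w‖ ^ 2 := by
  have h : Orthonormal ℝ ![e, n] := by
    rw [orthonormal_vecCons_iff]
    refine ⟨he, fun i => ?_, ?_⟩
    · simpa using hen
    · rw [orthonormal_vecCons_iff]
      refine ⟨hn, fun i => i.elim0, ?_⟩
      exact ⟨fun i => i.elim0, fun i => i.elim0⟩
  simpa [Fin.sum_univ_two] using h.sum_inner_products_le w (s := Finset.univ)

/-- A unit-speed curve leaving a point outside the ball of radius `r` about `c` orthogonally to the
radius, and turning no faster than a circle of radius `r`, stays outside for a quarter turn. -/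
theorem lt_norm_sub_of_cos_le_inner {γ u : ℝ → E} {c : E} {r b : ℝ} (hr : 0 < r) (hb : 0 ≤ b)
    (hbr : b / r ≤ π / 2) (hγ : ∀ t ∈ Icc 0 b, HasDerivAt γ (u t) t)
    (hu : ∀ t ∈ Icc 0 b, ‖u t‖ = 1)
    (hcos : ∀ t ∈ Icc 0 b, cos (t / r) ≤ inner ℝ (u 0) (u t))
    (horth : inner ℝ (u 0) (γ 0 - c) = 0) (hR : r < ‖γ 0 - c‖) : r < ‖γ b - c‖ := by
  set R := ‖γ 0 - c‖ with hRdef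
  have hR0 : 0 < R := hr.trans hR
  set n : E := R⁻¹ • (γ 0 - c) with hn
  have hn1 : ‖n‖ = 1 := by
    rw [hn, norm_smul, norm_inv, Real.norm_of_nonneg hR0.le, ← hRdef, inv_mul_cancel₀ hR0.ne']
  have hen : inner ℝ (u 0) n = 0 := by rw [hn, inner_smul_right, horth, mul_zero]
  have he1 : ‖u 0‖ = 1 := hu 0 ⟨le_rfl, hb⟩
  have hdiv : ∀ t ∈ Icc 0 b, 0 ≤ t / r ∧ t / r ≤ π / 2 := fun t ht =>
    ⟨div_nonneg ht.1 hr.le, ((div_le_div_iff_of_pos_right hr).2 ht.2).trans hbr⟩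
  have hsin : ∀ t ∈ Icc 0 b, -sin (t / r) ≤ inner ℝ n (u t) := by
    intro t ht
    obtain ⟨h0, h1⟩ := hdiv t ht
    have hB := sq_inner_add_sq_inner_le he1 hn1 hen (u t)
    have hc0 : 0 ≤ cos (t / r) := cos_nonneg_of_neg_pi_div_two_le_of_le (by linarith) h1
    have hs0 : 0 ≤ sin (t / r) := sin_nonneg_of_nonneg_of_le_pi h0 (by linarith [pi_pos])
    have hcs := cos_sq_add_sin_sq (t / r)
    have := pow_le_pow_left₀ hc0 (hcos t ht) 2
    rw [hu t ht] at hB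
    exact (abs_le_of_sq_le_sq' (by linarith) hs0).1
  have hE : r * sin (b / r) ≤ inner ℝ (u 0) (γ b - c) := by
    have hder : ∀ t ∈ Icc 0 b, HasDerivAt (fun t => inner ℝ (u 0) (γ t - c) - r * sin (t / r))
        (inner ℝ (u 0) (u t) - cos (t / r)) t := by
      intro t ht
      have h1 := (hasDerivAt_const t (u 0)).inner ℝ ((hγ t ht).sub_const c)
      have h2 := (((hasDerivAt_id t).div_const r).sin).const_mul r
      convert! h1.sub h2 using 1
      simp
      field_simp
    have hm := monotoneOn_of_hasDerivWithinAt_nonneg (convex_Icc 0 b)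
      (fun t ht => (hder t ht).continuousAt.continuousWithinAt)
      (fun t ht => (hder t (interior_subset ht)).hasDerivWithinAt)
      (fun t ht => sub_nonneg.2 (hcos t (interior_subset ht)))
    have := hm ⟨le_rfl, hb⟩ ⟨hb, le_rfl⟩ hb
    simp only [horth, zero_div, sin_zero, mul_zero, sub_zero] at this
    linarith
  have hN : R - r + r * cos (b / r) ≤ inner ℝ n (γ b - c) := by
    have hder : ∀ t ∈ Icc 0 b, HasDerivAt (fun t => inner ℝ n (γ t - c) - r * cos (t / r))
        (inner ℝ n (u t) + sin (t / r)) t := by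
      intro t ht
      have h1 := (hasDerivAt_const t n).inner ℝ ((hγ t ht).sub_const c)
      have h2 := (((hasDerivAt_id t).div_const r).cos).const_mul r
      convert! h1.sub h2 using 1
      simp
      field_simp
    have hm := monotoneOn_of_hasDerivWithinAt_nonneg (convex_Icc 0 b)
      (fun t ht => (hder t ht).continuousAt.continuousWithinAt)
      (fun t ht => (hder t (interior_subset ht)).hasDerivWithinAt)
      (fun t ht => by have := hsin t (interior_subset ht); linarith)
    have := hm ⟨le_rfl, hb⟩ ⟨hb, le_rfl⟩ hb
    have hn0 : inner ℝ n (γ 0 - c) = R := by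
      rw [hn, inner_smul_left, real_inner_self_eq_norm_sq, ← hRdef]
      simp
      field_simp
    simp only [hn0, zero_div, cos_zero, mul_one] at this
    linarith
  obtain ⟨h0, h1⟩ := hdiv b ⟨hb, le_rfl⟩
  have hc0 : 0 ≤ cos (b / r) := cos_nonneg_of_neg_pi_div_two_le_of_le (by linarith) h1
  have hs0 : 0 ≤ sin (b / r) := sin_nonneg_of_nonneg_of_le_pi h0 (by linarith [pi_pos])
  have hB := sq_inner_add_sq_inner_le he1 hn1 hen (γ b - c)
  have hE2 := pow_le_pow_left₀ (mul_nonneg hr.le hs0) hE 2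
  have hN2 := pow_le_pow_left₀ (by have := mul_nonneg hr.le hc0; linarith) hN 2
  have hcs := cos_sq_add_sin_sq (b / r)
  refine lt_of_pow_lt_pow_left₀ 2 (norm_nonneg _) ?_
  have h3 : r ^ 2 < (r * sin (b / r)) ^ 2 + (R - r + r * cos (b / r)) ^ 2 := by
    have h4 : (r * sin (b / r)) ^ 2 + (r * cos (b / r)) ^ 2 = r ^ 2 := by
      rw [mul_pow, mul_pow, ← mul_add, add_comm, hcs, mul_one]
    have h5 := mul_nonneg (sub_pos.2 hR).le (mul_nonneg hr.le hc0)
    have h6 := pow_pos (sub_pos.2 hR) 2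
    nlinarith
  linarith

end General

namespace IsKConstrained

variable {κ r s : ℝ} {σ σ' σ'' : ℝ → Plane}

theorem norm_sub_le (h : IsKConstrained κ s σ σ' σ'') {t u : ℝ} (ht : t ∈ Icc 0 s)
    (hu : u ∈ Icc 0 s) (htu : t ≤ u) : ‖σ' u - σ' t‖ ≤ κ * (u - t) := by
  obtain ⟨-, -, hc, -, F, hF⟩ := h
  have hsub : Icc t u ⊆ Icc 0 s := Icc_subset_Icc ht.1 hu.2
  exact norm_sub_le_of_norm_hasDerivAt_le_off_finset htu (hc.mono hsub) F
    fun w hw => hF w (hsub hw)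

theorem cos_le_inner_of_le (h : IsKConstrained (1 / r) s σ σ' σ'') {t u : ℝ} (ht : t ∈ Icc 0 s)
    (hu : u ∈ Icc 0 s) (htu : t ≤ u) (hπ : (u - t) / r ≤ π) :
    cos ((u - t) / r) ≤ inner ℝ (σ' t) (σ' u) := by
  have hsub : Icc t u ⊆ Icc 0 s := Icc_subset_Icc ht.1 hu.2
  rw [← one_div_mul_eq_div] at hπ ⊢
  exact cos_le_inner_of_lipschitz htu (fun w hw => h.2.2.2.1 w (hsub hw))
    (fun w hw z hz hwz => h.norm_sub_le (hsub hw) (hsub hz) hwz) hπ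

theorem cos_le_inner (h : IsKConstrained (1 / r) s σ σ' σ'') {t u : ℝ} (ht : t ∈ Icc 0 s)
    (hu : u ∈ Icc 0 s) (hπ : |(u - t) / r| ≤ π) :
    cos ((u - t) / r) ≤ inner ℝ (σ' t) (σ' u) := by
  rcases le_total t u with htu | htu
  · exact h.cos_le_inner_of_le ht hu htu ((le_abs_self _).trans hπ)
  · have heq : (t - u) / r = -((u - t) / r) := by ring
    rw [real_inner_comm, ← cos_neg, ← heq]
    exact h.cos_le_inner_of_le hu ht htu (heq ▸ (neg_le_abs _).trans hπ)

/-- **Schur's comparison theorem** with a circle: a curve of curvature at most `1 / r` and length at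
most `2 * π * r` has a chord at least as long as the circular arc of the same length. -/
theorem two_mul_mul_sin_le_dist (h : IsKConstrained (1 / r) s σ σ' σ'') (hr : 0 < r)
    (hs : s ≤ 2 * π * r) : 2 * r * sin (s / (2 * r)) ≤ dist (σ 0) (σ s) := by
  obtain ⟨hs0, hσ, -, hunit, -⟩ := id h
  have hm : s / 2 ∈ Icc 0 s := ⟨by linarith, by linarith⟩
  have hder : ∀ t ∈ Icc 0 s, HasDerivAt
      (fun t => inner ℝ (σ' (s / 2)) (σ t) - r * sin ((t - s / 2) / r))
      (inner ℝ (σ' (s / 2)) (σ' t) - cos ((t - s / 2) / r)) t := by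
    intro t ht
    have h1 := (hasDerivAt_const t (σ' (s / 2))).inner ℝ (hσ t ht)
    have h2 := ((((hasDerivAt_id t).sub_const (s / 2)).div_const r).sin).const_mul r
    convert! h1.sub h2 using 1
    simp
    field_simp
  have hmono := monotoneOn_of_hasDerivWithinAt_nonneg (convex_Icc 0 s)
    (fun t ht => (hder t ht).continuousAt.continuousWithinAt)
    (fun t ht => (hder t (interior_subset ht)).hasDerivWithinAt)
    (fun t ht => sub_nonneg.2 (h.cos_le_inner hm (interior_subset ht) (by
      have ht' := interior_subset ht
      rw [abs_div, abs_of_pos hr, div_le_iff₀ hr, abs_le]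
      constructor <;> linarith [ht'.1, ht'.2])))
  have hle := hmono ⟨le_rfl, hs0⟩ ⟨hs0, le_rfl⟩ hs0
  have e1 : (0 - s / 2) / r = -(s / (2 * r)) := by field_simp; ring
  have e2 : (s - s / 2) / r = s / (2 * r) := by field_simp; ring
  simp only [e1, e2, sin_neg] at hle
  have hcs := real_inner_le_norm (σ' (s / 2)) (σ s - σ 0)
  rw [hunit _ hm, one_mul, inner_sub_right, ← dist_eq_norm, dist_comm] at hcs
  linarith

theorem dist_le_of_lt_pi_mul (h : IsKConstrained (1 / r) s σ σ' σ'') (hr : 0 < r)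
    (hs : s < π * r) {c : Plane} (h0 : dist (σ 0) c ≤ r) (h1 : dist (σ s) c ≤ r) {t : ℝ}
    (ht : t ∈ Icc 0 s) : dist (σ t) c ≤ r := by
  obtain ⟨hs0, hσ, -, hunit, -⟩ := id h
  by_contra! hlt
  have hcont : ContinuousOn (fun t => ‖σ t - c‖ ^ 2) (Icc 0 s) := fun t ht =>
    (((hσ t ht).sub_const c).norm_sq).continuousAt.continuousWithinAt
  obtain ⟨m, hm, hmax⟩ := isCompact_Icc.exists_isMaxOn ⟨t, ht⟩ hcont
  have hmr : r < ‖σ m - c‖ := by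
    rw [dist_eq_norm] at hlt
    exact hlt.trans_le (le_of_sq_le_sq (hmax ht) (norm_nonneg _))
  have hm0 : 0 < m := hm.1.lt_of_ne (by
    rintro rfl
    rw [← dist_eq_norm] at hmr
    linarith)
  have hms : m < s := hm.2.lt_of_ne (by
    rintro rfl
    rw [← dist_eq_norm] at hmr
    linarith)
  have horth : inner ℝ (σ' m) (σ m - c) = 0 := by
    have hz := (hmax.isLocalMax (Icc_mem_nhds hm0 hms)).hasDerivAt_eq_zero
      ((hσ m hm).sub_const c).norm_sq
    rw [real_inner_comm]
    linarith
  rcases le_total m (s - m) with hle | hle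
  · have hmem : ∀ u ∈ Icc 0 m, m - u ∈ Icc 0 s := fun u hu =>
      ⟨by linarith [hu.2], by linarith [hu.1]⟩
    have := lt_norm_sub_of_cos_le_inner (γ := fun u => σ (m - u)) (u := fun u => -σ' (m - u))
      (c := c) (b := m) hr hm0.le (by rw [div_le_iff₀ hr]; linarith)
      (fun u hu => HasDerivAt.comp_const_sub m u (hσ _ (hmem u hu)))
      (fun u hu => by rw [norm_neg]; exact hunit _ (hmem u hu))
      (fun u hu => by
        have hc := h.cos_le_inner hm (hmem u hu) (by
          rw [abs_div, abs_of_pos hr, div_le_iff₀ hr, abs_le]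
          constructor <;> linarith [hu.1, hu.2])
        have e : (m - u - m) / r = -(u / r) := by ring
        rw [e, cos_neg] at hc
        simpa using hc)
      (by simpa using horth) (by simpa using hmr)
    rw [sub_self, ← dist_eq_norm] at this
    linarith
  · have hmem : ∀ u ∈ Icc 0 (s - m), m + u ∈ Icc 0 s := fun u hu =>
      ⟨by linarith [hu.1], by linarith [hu.2]⟩
    have := lt_norm_sub_of_cos_le_inner (γ := fun u => σ (m + u)) (u := fun u => σ' (m + u))
      (c := c) (b := s - m) hr (by linarith) (by rw [div_le_iff₀ hr]; linarith)
      (fun u hu => HasDerivAt.comp_const_add m u (hσ _ (hmem u hu)))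
      (fun u hu => hunit _ (hmem u hu))
      (fun u hu => by
        have hc := h.cos_le_inner hm (hmem u hu) (by
          rw [abs_div, abs_of_pos hr, div_le_iff₀ hr, abs_le]
          constructor <;> linarith [hu.1, hu.2])
        rw [add_sub_cancel_left] at hc
        simpa using hc)
      (by simpa using horth) (by simpa using hmr)
    rw [add_sub_cancel, ← dist_eq_norm] at this
    linarith

end IsKConstrained

theorem closure_interior_inter_closedBall {r : ℝ} {x y c₁ c₂ : Plane} (hxy : x ≠ y)
    (hc₁x : dist c₁ x = r) (hc₁y : dist c₁ y = r) (hc₂x : dist c₂ x = r) (hc₂y : dist c₂ y = r) :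
    closure (interior (closedBall c₁ r ∩ closedBall c₂ r)) =
      closedBall c₁ r ∩ closedBall c₂ r := by
  have hmid : ∀ c : Plane, dist c x = r → dist c y = r → midpoint ℝ x y ∈ ball c r := by
    intro c hx hy
    have hcomb := combo_mem_ball_of_ne (z := c) (r := r) (mem_closedBall'.2 hx.le)
      (mem_closedBall'.2 hy.le) hxy (a := 1 / 2) (b := 1 / 2) (by norm_num) (by norm_num)
      (by norm_num)
    rwa [midpoint_eq_smul_add, smul_add, invOf_eq_inv, ← one_div]
  have hne : (interior (closedBall c₁ r ∩ closedBall c₂ r)).Nonempty :=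
    ⟨midpoint ℝ x y, interior_maximal
      (inter_subset_inter ball_subset_closedBall ball_subset_closedBall)
      (isOpen_ball.inter isOpen_ball) ⟨hmid c₁ hc₁x hc₁y, hmid c₂ hc₂x hc₂y⟩⟩
  rw [((convex_closedBall c₁ r).inter
      (convex_closedBall c₂ r)).closure_interior_eq_closure_of_nonempty_interior hne,
    (isClosed_closedBall.inter isClosed_closedBall).closure_eq]

theorem norm_cos_smul_add_sin_smul {a b : Plane} {r : ℝ} (hr : 0 ≤ r) (ha : ‖a‖ = r)
    (hb : ‖b‖ = r) (hab : inner ℝ a b = 0) (θ : ℝ) : ‖cos θ • a + sin θ • b‖ = r := by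
  rw [← sq_eq_sq₀ (norm_nonneg _) hr, norm_add_sq_real, norm_smul, norm_smul, inner_smul_left,
    inner_smul_right, hab, ha, hb, mul_pow, mul_pow, Real.norm_eq_abs, Real.norm_eq_abs, sq_abs,
    sq_abs]
  linear_combination r ^ 2 * cos_sq_add_sin_sq θ

theorem isKConstrained_circle {a b : Plane} {r : ℝ} (hr : 0 < r) (ha : ‖a‖ = r) (hb : ‖b‖ = r)
    (hab : inner ℝ a b = 0) (c : Plane) {s : ℝ} (hs : 0 ≤ s) :
    IsKConstrained (1 / r) s (fun t => c + (cos (t / r) • a + sin (t / r) • b))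
      (fun t => r⁻¹ • (cos (t / r) • b + sin (t / r) • -a))
      (fun t => (r⁻¹ * r⁻¹) • (cos (t / r) • -a + sin (t / r) • -b)) := by
  have hcs : ∀ (u w : Plane) (t : ℝ), HasDerivAt (fun t => cos (t / r) • u + sin (t / r) • w)
      (r⁻¹ • (cos (t / r) • w + sin (t / r) • -u)) t := by
    intro u w t
    have h0 := (hasDerivAt_id t).div_const r
    convert! (h0.cos.smul_const u).add (h0.sin.smul_const w) using 1
    simp only [id, one_div]
    module
  have h2 : ∀ t, HasDerivAt (fun t => r⁻¹ • (cos (t / r) • b + sin (t / r) • -a))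
      ((r⁻¹ * r⁻¹) • (cos (t / r) • -a + sin (t / r) • -b)) t := by
    intro t
    rw [mul_smul]
    exact (hcs b (-a) t).const_smul r⁻¹
  refine ⟨hs, fun t _ => (hcs a b t).const_add c,
    fun t _ => (h2 t).continuousAt.continuousWithinAt, fun t _ => ?_, ∅, fun t _ _ => ⟨h2 t, ?_⟩⟩
  · rw [norm_smul, norm_cos_smul_add_sin_smul hr.le hb (by rwa [norm_neg])
      (by rw [inner_neg_right, real_inner_comm, hab, neg_zero]), norm_inv,
      Real.norm_of_nonneg hr.le, inv_mul_cancel₀ hr.ne']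
  · rw [norm_smul, norm_cos_smul_add_sin_smul hr.le (by rwa [norm_neg]) (by rwa [norm_neg])
      (by rw [inner_neg_neg, hab]), norm_mul, norm_inv, Real.norm_of_nonneg hr.le,
      mul_assoc, inv_mul_cancel₀ hr.ne', mul_one, one_div]

/-- The point of the circle `sphere c₁ r` opposite to the chord from `x` to `y` is farther than `r`
from the centre of any other radius-`r` circle through `x` and `y`. -/
theorem lt_norm_neg_smul_add_sub {a b k : Plane} {r l : ℝ} (hl : 0 < l)
    (hab : ‖(-l) • (a + b)‖ = r) (ha : ‖a‖ = r) (hb : ‖b‖ = r) (hka : ‖k - a‖ = r)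
    (hkb : ‖k - b‖ = r) (hk : k ≠ 0) : r < ‖(-l) • (a + b) - k‖ := by
  have hk0 : 0 < ‖k‖ := norm_pos_iff.2 hk
  have h1 := norm_sub_sq_real k a
  have h2 := norm_sub_sq_real k b
  have h3 := norm_sub_sq_real ((-l) • (a + b)) k
  rw [hab, inner_smul_left, inner_add_left, real_inner_comm k a, real_inner_comm k b] at h3
  simp only [conj_trivial] at h3
  rw [hka, ha] at h1
  rw [hkb, hb] at h2
  refine lt_of_pow_lt_pow_left₀ 2 (norm_nonneg _) ?_
  have := mul_pos hl (pow_pos hk0 2)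
  have := pow_pos hk0 2
  nlinarith

/-- For 0 < dist(x,y) = d < 2r, among (1/r)-constrained curves from x to y not
contained in the closed lens cl(I), the minimal length is
r·(2π − 2·arcsin(d/(2r))), achieved by the longer arc of a radius-r circle
through x and y. -/
theorem min_length_outside_lens (r d : ℝ) (hr : 0 < r)
    (hd : 0 < d) (hd2 : d < 2 * r)
    (x y c₁ c₂ : Plane) (hxy : dist x y = d)
    (hc₁x : dist c₁ x = r) (hc₁y : dist c₁ y = r)
    (hc₂x : dist c₂ x = r) (hc₂y : dist c₂ y = r)
    (hcc : c₁ ≠ c₂) :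
    (∀ (s : ℝ) (σ σ' σ'' : ℝ → Plane),
        IsKConstrained (1 / r) s σ σ' σ'' →
        σ 0 = x → σ s = y →
        ¬ (∀ t ∈ Icc (0:ℝ) s,
            σ t ∈ closure (interior (closedBall c₁ r ∩ closedBall c₂ r))) →
        r * (2 * π - 2 * Real.arcsin (d / (2 * r))) ≤ s) ∧
    (∃ σ σ' σ'' : ℝ → Plane,
        IsKConstrained (1 / r) (r * (2 * π - 2 * Real.arcsin (d / (2 * r)))) σ σ' σ'' ∧
        σ 0 = x ∧ σ (r * (2 * π - 2 * Real.arcsin (d / (2 * r)))) = y ∧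
        (∀ t ∈ Icc (0:ℝ) (r * (2 * π - 2 * Real.arcsin (d / (2 * r)))),
            σ t ∈ sphere c₁ r) ∧
        ¬ (∀ t ∈ Icc (0:ℝ) (r * (2 * π - 2 * Real.arcsin (d / (2 * r)))),
            σ t ∈ closure (interior (closedBall c₁ r ∩ closedBall c₂ r)))) := by
  have hxne : x ≠ y := dist_pos.1 (hxy ▸ hd)
  rw [closure_interior_inter_closedBall hxne hc₁x hc₁y hc₂x hc₂y]
  set α := arcsin (d / (2 * r)) with hα
  have hq0 : 0 < d / (2 * r) := by positivity
  have hq1 : d / (2 * r) < 1 := (div_lt_one (by positivity)).2 hd2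
  have hα0 : 0 < α := arcsin_pos.2 hq0
  have hα1 : α < π / 2 := arcsin_lt_pi_div_two.2 hq1
  have hsinα : 2 * r * sin α = d := by
    rw [hα, sin_arcsin (by linarith) hq1.le]
    field_simp
  constructor
  · intro s σ σ' σ'' h hσ0 hσs hnot
    by_contra! hlt
    rcases lt_or_ge s (π * r) with hsπ | hsπ
    · have hball : ∀ c : Plane, dist c x = r → dist c y = r → ∀ t ∈ Icc 0 s,
          σ t ∈ closedBall c r := fun c hx hy t ht =>
        h.dist_le_of_lt_pi_mul hr hsπ (by rw [hσ0, dist_comm, hx]) (by rw [hσs, dist_comm, hy]) ht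
      exact hnot fun t ht => ⟨hball c₁ hc₁x hc₁y t ht, hball c₂ hc₂x hc₂y t ht⟩
    · have hle := h.two_mul_mul_sin_le_dist hr (by nlinarith)
      rw [hσ0, hσs, hxy, ← hsinα] at hle
      have h1 : π / 2 ≤ s / (2 * r) := by
        rw [le_div_iff₀ (by positivity)]
        linarith
      have h2 : s / (2 * r) < π - α := by
        rw [div_lt_iff₀ (by positivity)]
        linarith
      have h3 : sin α < sin (π - s / (2 * r)) :=
        sin_lt_sin_of_lt_of_le_pi_div_two (by linarith) (by linarith) (by linarith)
      rw [sin_pi_sub] at h3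
      have := mul_lt_mul_of_pos_left h3 (show 0 < 2 * r by positivity)
      linarith
  · set a := x - c₁ with ha
    set b := y - c₁ with hb
    have hna : ‖a‖ = r := by rw [ha, ← dist_eq_norm, dist_comm, hc₁x]
    have hnb : ‖b‖ = r := by rw [hb, ← dist_eq_norm, dist_comm, hc₁y]
    have hs2 : 0 < sin (2 * α) := sin_pos_of_pos_of_lt_pi (by linarith) (by linarith)
    have hcα : 0 < cos α := cos_pos_of_mem_Ioo ⟨by linarith, hα1⟩
    have hinner : inner ℝ a b = r ^ 2 * cos (2 * α) := by
      have h1 := norm_sub_sq_real a b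
      rw [ha, hb, sub_sub_sub_cancel_right, ← dist_eq_norm, hxy, ← ha, ← hb, hna, hnb,
        ← hsinα] at h1
      rw [cos_two_mul, cos_sq']
      linarith
    set p := (sin (2 * α))⁻¹ • (cos (2 * α) • a - b) with hp
    have hap : inner ℝ a p = 0 := by
      rw [hp, inner_smul_right, inner_sub_right, inner_smul_right, real_inner_self_eq_norm_sq,
        hna, hinner]
      ring
    have hnp : ‖p‖ = r := by
      rw [← sq_eq_sq₀ (norm_nonneg _) hr.le, hp, norm_smul, mul_pow, norm_sub_sq_real, norm_smul,
        inner_smul_left, hinner, hna, hnb, mul_pow, Real.norm_eq_abs, Real.norm_eq_abs, sq_abs,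
        sq_abs, inv_pow, conj_trivial]
      field_simp
      linear_combination -cos_sq_add_sin_sq (2 * α)
    have hpb : cos (2 * α) • a - sin (2 * α) • p = b := by
      rw [hp, smul_inv_smul₀ hs2.ne', sub_sub_cancel]
    set L := r * (2 * π - 2 * α) with hL
    have hL0 : 0 ≤ L := mul_nonneg hr.le (by linarith)
    have hLr : L / r = 2 * π - 2 * α := by rw [hL]; field_simp
    refine ⟨_, _, _, isKConstrained_circle hr hna hnp hap c₁ hL0, ?_, ?_, fun t _ => ?_,
      fun hall => ?_⟩
    · simp [ha]
    · have e : cos (2 * π - 2 * α) • a + sin (2 * π - 2 * α) • p = b := by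
        rw [cos_two_pi_sub, sin_two_pi_sub, neg_smul, ← sub_eq_add_neg, hpb]
      simp only [hLr, e, hb, add_sub_cancel]
    · rw [mem_sphere_iff_norm, add_sub_cancel_left]
      exact norm_cos_smul_add_sin_smul hr.le hna hnp hap _
    · have hmem := (hall (L / 2) ⟨by linarith, by linarith⟩).2
      have hhalf : L / 2 / r = π - α := by rw [div_right_comm, hLr]; ring
      have hopp : cos (π - α) • a + sin (π - α) • p = (-(2 * cos α)⁻¹) • (a + b) := by
        have hab : a + b = (2 * cos α) • (cos α • a - sin α • p) :=
          calc a + b = a + (cos (2 * α) • a - sin (2 * α) • p) := by rw [hpb]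
            _ = (2 * cos α) • (cos α • a - sin α • p) := by
              rw [cos_two_mul, sin_two_mul]
              module
        rw [hab, neg_smul, inv_smul_smul₀ (by positivity), cos_pi_sub, sin_pi_sub]
        module
      have hnorm := norm_cos_smul_add_sin_smul hr.le hna hnp hap (π - α)
      rw [hopp] at hnorm
      have hfar := lt_norm_neg_smul_add_sub (k := c₂ - c₁) (l := (2 * cos α)⁻¹) (by positivity)
        hnorm hna hnb
        (by rw [ha, sub_sub_sub_cancel_right, ← dist_eq_norm, hc₂x])
        (by rw [hb, sub_sub_sub_cancel_right, ← dist_eq_norm, hc₂y])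
        (sub_ne_zero.2 hcc.symm)
      rw [mem_closedBall, hhalf, hopp, dist_eq_norm] at hmem
      have e : c₁ + (-(2 * cos α)⁻¹) • (a + b) - c₂ =
          (-(2 * cos α)⁻¹) • (a + b) - (c₂ - c₁) := by abel
      rw [e] at hmem
      linarith
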